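/- Let N ≥ 2, let n ≥ 1, and for k = 1,…,N let n/2 < s_k ≤ n, n/s_k < p_k < ∞, q_k = n/s_k, and 1/p_1+⋯+1/p_N = 1/p. Then there exist weights w_1,…,w_N : ℝⁿ → [0,∞) with (w_1,…,w_N) ∈ A_{P⃗/Q⃗} (where P⃗ = (p_1,…,p_N), Q⃗ = (q_1,…,q_N)) such that, for every function Ψ ∈ 𝒮(ℝ^{Nn}) with supp Ψ ⊂ {ξ : 1/2 ≤ |ξ| ≤ 2} and Σ_{k∈ℤ} Ψ(ξ/2^k) = 1 for all ξ ≠ 0, there is NO constant C > 0 for which ‖T_m(f_1,…,f_N)‖_{L^p(ν_w)} ≤ C · (sup_{j∈ℤ} ‖m_j‖_{W^{(s_1,…,s_N)}(ℝ^{Nn})}) · Π_{k=1}^N ‖f_k‖_{L^{p_k}(w_k)} holds for all m ∈ L^∞(ℝ^{Nn}) and all f_1,…,f_N ∈ 𝒮(ℝⁿ), where m_j(ξ) = m(2^j ξ)Ψ(ξ) and ν_w = Π_{k=1}^N w_k^{p/p_k}. -/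

import Mathlib

open MeasureTheory Real Complex
open scoped RealInnerProductSpace ENNReal BigOperators

noncomputable section

/-- The Fourier transform `f̂(ξ) = ∫ e^{-ix·ξ} f(x) dx` on a Euclidean space. -/
def fint {ι : Type*} [Fintype ι] (f : EuclideanSpace ℝ ι → ℂ) (ξ : EuclideanSpace ℝ ι) : ℂ :=
  ∫ x, Complex.exp (-(Complex.I * ((⟪x, ξ⟫ : ℝ) : ℂ))) * f x

/-- The `k`-th block `ξ_k ∈ ℝⁿ` of `ξ ∈ ℝ^{Nn} = (ℝⁿ)^N`. -/
def blk {N n : ℕ} (ξ : EuclideanSpace ℝ (Fin N × Fin n)) (k : Fin N) :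
    EuclideanSpace ℝ (Fin n) :=
  (WithLp.equiv 2 (Fin n → ℝ)).symm (fun i => ξ (k, i))

/-- The `N`-linear Fourier multiplier operator
`T_m(f₁,…,f_N)(x) = (2π)^{-Nn} ∫ e^{ix·(ξ₁+⋯+ξ_N)} m(ξ) f̂₁(ξ₁)⋯f̂_N(ξ_N) dξ`. -/
def Tm {N n : ℕ} (m : EuclideanSpace ℝ (Fin N × Fin n) → ℂ)
    (f : Fin N → (EuclideanSpace ℝ (Fin n) → ℂ)) (x : EuclideanSpace ℝ (Fin n)) : ℂ :=
  (((2 * π) ^ (N * n) : ℝ) : ℂ)⁻¹ *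
    ∫ ξ, Complex.exp (Complex.I * ((⟪x, ∑ k, blk ξ k⟫ : ℝ) : ℂ)) * m ξ *
      ∏ k, fint (f k) (blk ξ k)

/-- The product-type Sobolev (quasi-)norm
`‖F‖_{W^{(t₁,…,t_N)}(ℝ^{Nn})} = (∫ Π_k (1+|ξ_k|²)^{t_k} |F̂(ξ)|² dξ)^{1/2}`,
with values in `ℝ≥0∞`. -/
def sobolevProd {N n : ℕ} (t : Fin N → ℝ)
    (F : EuclideanSpace ℝ (Fin N × Fin n) → ℂ) : ℝ≥0∞ :=
  (∫⁻ ξ : EuclideanSpace ℝ (Fin N × Fin n),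
    ENNReal.ofReal ((∏ k, (1 + ‖blk ξ k‖ ^ 2) ^ (t k)) * ‖fint F ξ‖ ^ 2)) ^ ((1 : ℝ) / 2)

/-- The weighted Lebesgue (quasi-)norm `‖f‖_{L^q(w)} = (∫ |f|^q w dx)^{1/q}`,
with values in `ℝ≥0∞`. -/
def wLp {n : ℕ} (q : ℝ) (w : EuclideanSpace ℝ (Fin n) → ℝ)
    (f : EuclideanSpace ℝ (Fin n) → ℂ) : ℝ≥0∞ :=
  (∫⁻ x, ENNReal.ofReal (‖f x‖ ^ q * w x)) ^ (1 / q)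

/-- The axis-parallel cube with lower corner `c` and side length `h` in `ℝⁿ`. -/
def cube (n : ℕ) (c : Fin n → ℝ) (h : ℝ) : Set (EuclideanSpace ℝ (Fin n)) :=
  {x | ∀ i, c i ≤ x i ∧ x i ≤ c i + h}

/-- The class `A_{P⃗/Q⃗}` for `P⃗ = (p₁,…,p_N)`, `Q⃗ = (q₁,…,q_N)` and combined exponent `p`
with `1/p = Σ 1/p_k`: membership of `(w₁,…,w_N)` means
`sup_Q (|Q|⁻¹ ∫_Q ν_w)^{1/p} Π_k (|Q|⁻¹ ∫_Q w_k^{1-(p_k/q_k)'})^{1/q_k - 1/p_k} < ∞`,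
where `ν_w = Π_k w_k^{p/p_k}` and `(p_k/q_k)' = (p_k/q_k)/((p_k/q_k) - 1)`. -/
def IsMultiApq (n N : ℕ) (p : ℝ) (pk qk : Fin N → ℝ)
    (w : Fin N → EuclideanSpace ℝ (Fin n) → ℝ) : Prop :=
  ∃ A : ℝ, ∀ (c : Fin n → ℝ) (h : ℝ), 0 < h →
    ((h ^ n)⁻¹ * ∫ x in cube n c h, ∏ k, w k x ^ (p / pk k)) ^ (1 / p) *
      ∏ k, ((h ^ n)⁻¹ *
        ∫ x in cube n c h,
          w k x ^ (1 - (pk k / qk k) / (pk k / qk k - 1))) ^ (1 / qk k - 1 / pk k) ≤ A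

theorem norm_le_of_mem_cube {n : ℕ} {c : Fin n → ℝ} {h : ℝ} (hh : 0 < h)
    {x : EuclideanSpace ℝ (Fin n)} (hx : x ∈ cube n c h) : ‖x‖ ≤ n * (‖c‖ + h) := by
  have h1 : ∀ i, |x i| ≤ ‖c‖ + h := fun i => by
    have hc : |c i| ≤ ‖c‖ := norm_le_pi_norm c i
    have := hx i
    rw [abs_le] at hc ⊢
    constructor <;> linarith
  have hu : 0 ≤ ‖c‖ + h := by positivity
  have h2 : ‖x‖ ≤ ∑ i, |x i| := by
    rw [EuclideanSpace.norm_eq]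
    refine (Real.sqrt_le_sqrt (Finset.sum_sq_le_sq_sum_of_nonneg
      (f := fun i => ‖x i‖) fun i _ => norm_nonneg _)).trans ?_
    rw [Real.sqrt_sq (Finset.sum_nonneg fun i _ => norm_nonneg _)]
    simp
  refine h2.trans ((Finset.sum_le_sum fun i _ => h1 i).trans ?_)
  simp [mul_add]

theorem le_norm_of_mem_cube {n : ℕ} {c : Fin n → ℝ} {h : ℝ} (hh : 0 < h)
    {x : EuclideanSpace ℝ (Fin n)} (hx : x ∈ cube n c h) : ‖c‖ - h ≤ ‖x‖ := by
  have : ‖c‖ ≤ ‖x‖ + h := by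
    refine (pi_norm_le_iff_of_nonneg (by positivity)).2 fun i => ?_
    have h1 : |x i| ≤ ‖x‖ := PiLp.norm_apply_le x i
    have := hx i
    rw [Real.norm_eq_abs]
    rw [abs_le] at h1 ⊢
    constructor <;> linarith
  linarith

theorem cube_eq_preimage (n : ℕ) (c : Fin n → ℝ) (h : ℝ) :
    cube n c h = (MeasurableEquiv.toLp 2 (Fin n → ℝ)).symm ⁻¹'
      Set.Icc c (fun i => c i + h) := by
  ext x
  simp [cube, Set.mem_Icc, Pi.le_def, forall_and]

theorem measurableSet_cube (n : ℕ) (c : Fin n → ℝ) (h : ℝ) : MeasurableSet (cube n c h) := by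
  rw [cube_eq_preimage]
  exact (MeasurableEquiv.measurable _) measurableSet_Icc

theorem volume_cube (n : ℕ) (c : Fin n → ℝ) {h : ℝ} (hh : 0 < h) :
    volume (cube n c h) = ENNReal.ofReal (h ^ n) := by
  rw [cube_eq_preimage, (EuclideanSpace.volume_preserving_symm_measurableEquiv_toLp
    (Fin n)).measure_preimage measurableSet_Icc.nullMeasurableSet, Real.volume_Icc_pi]
  simp [ENNReal.ofReal_pow hh.le]

theorem integrableOn_ball_norm_rpow {n : ℕ} (hn : 1 ≤ n) {γ : ℝ} (hγ : -(n : ℝ) < γ) (r : ℝ) :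
    IntegrableOn (fun x : EuclideanSpace ℝ (Fin n) => ‖x‖ ^ γ) (Metric.ball 0 r) := by
  refine integrableOn_ball_of_norm_le_rpow (C := 1) (α := -γ) (by simpa using hn)
    (by simp; linarith) (.of_forall fun x => ?_)
    (measurable_norm.pow_const _).aestronglyMeasurable
  rw [Real.norm_of_nonneg (by positivity)]
  simp

theorem setIntegral_ball_norm_rpow {n : ℕ} (γ : ℝ) {r : ℝ} (hr : 0 < r) :
    ∫ x in Metric.ball (0 : EuclideanSpace ℝ (Fin n)) r, ‖x‖ ^ γ
      = r ^ n * r ^ γ * ∫ x in Metric.ball (0 : EuclideanSpace ℝ (Fin n)) 1, ‖x‖ ^ γ := by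
  have h := Measure.setIntegral_comp_smul_of_pos volume
    (fun x : EuclideanSpace ℝ (Fin n) => ‖x‖ ^ γ) (Metric.ball 0 1) hr
  have h2 : ∀ x : EuclideanSpace ℝ (Fin n), ‖r • x‖ ^ γ = r ^ γ * ‖x‖ ^ γ := fun x => by
    rw [norm_smul, Real.norm_of_nonneg hr.le, Real.mul_rpow hr.le (norm_nonneg _)]
  simp only [h2, integral_const_mul, smul_unitBall_of_pos hr, finrank_euclideanSpace,
    Fintype.card_fin, smul_eq_mul] at h
  rw [mul_assoc, h, ← mul_assoc, mul_inv_cancel₀ (by positivity), one_mul]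

/-- Cube averages of the power `‖x‖ ^ γ`, `γ > -n`, are at most of the order of its value at the
far end of the cube. -/
theorem cube_average_norm_rpow_le {n : ℕ} (hn : 1 ≤ n) {γ : ℝ} (hγ : -(n : ℝ) < γ) :
    ∃ K : ℝ, 0 ≤ K ∧ ∀ (c : Fin n → ℝ) (h : ℝ), 0 < h →
      (h ^ n)⁻¹ * ∫ x in cube n c h, ‖x‖ ^ γ ≤ K * (‖c‖ + h) ^ γ := by
  set I := ∫ x in Metric.ball (0 : EuclideanSpace ℝ (Fin n)) 1, ‖x‖ ^ γ with hI
  have hI0 : 0 ≤ I := integral_nonneg fun x => by positivity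
  have hn0 : (0 : ℝ) < n := by exact_mod_cast hn
  refine ⟨((n : ℝ) ^ γ + (1 / 3) ^ γ) + 3 ^ n * ((n + 1) ^ n * (n + 1) ^ γ * I), by positivity,
    fun c h hh => ?_⟩
  set u := ‖c‖ + h with hu
  have hu0 : 0 < u := by positivity
  rw [add_mul]
  rcases le_or_gt (2 * h) ‖c‖ with hc | hc
  · have key : ∀ x ∈ cube n c h, ‖(‖x‖ ^ γ : ℝ)‖ ≤ ((n : ℝ) ^ γ + (1 / 3) ^ γ) * u ^ γ := by
      intro x hx
      have h1 := norm_le_of_mem_cube hh hx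
      have h2 : 1 / 3 * u ≤ ‖x‖ := by
        have := le_norm_of_mem_cube hh hx
        linarith
      rw [Real.norm_of_nonneg (by positivity), add_mul, ← Real.mul_rpow hn0.le hu0.le,
        ← Real.mul_rpow (by norm_num) hu0.le]
      rcases le_or_gt 0 γ with h0 | h0
      · have := Real.rpow_le_rpow (norm_nonneg x) h1 h0
        have : 0 ≤ (1 / 3 * u) ^ γ := by positivity
        linarith
      · have := Real.rpow_le_rpow_of_nonpos (by positivity) h2 h0.le
        have : 0 ≤ (n * u) ^ γ := by positivity
        linarith
    have := norm_setIntegral_le_of_norm_le_const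
      (by rw [volume_cube n c hh]; exact ENNReal.ofReal_lt_top) key
    rw [Real.norm_of_nonneg (integral_nonneg fun x => by positivity), Measure.real,
      volume_cube n c hh, ENNReal.toReal_ofReal (by positivity)] at this
    have h3 : (h ^ n)⁻¹ * ∫ x in cube n c h, ‖x‖ ^ γ ≤ ((n : ℝ) ^ γ + (1 / 3) ^ γ) * u ^ γ := by
      rw [inv_mul_le_iff₀ (by positivity)]
      linarith
    refine h3.trans (le_add_of_nonneg_right (by positivity))
  · have hsub : cube n c h ⊆ Metric.ball 0 ((n + 1) * u) := fun x hx => by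
      have := norm_le_of_mem_cube hh hx
      rw [mem_ball_zero_iff]
      linarith
    have h1 : ∫ x in cube n c h, ‖x‖ ^ γ ≤ ((n + 1) * u) ^ n * ((n + 1) * u) ^ γ * I := by
      rw [← setIntegral_ball_norm_rpow γ (by positivity)]
      exact setIntegral_mono_set (integrableOn_ball_norm_rpow hn hγ _)
        (.of_forall fun x => by positivity) hsub.eventuallyLE
    have h2 : (h ^ n)⁻¹ * u ^ n ≤ 3 ^ n := by
      rw [inv_mul_le_iff₀ (by positivity), ← mul_pow]
      gcongr
      linarith
    calc (h ^ n)⁻¹ * ∫ x in cube n c h, ‖x‖ ^ γ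
        ≤ (h ^ n)⁻¹ * (((n + 1) * u) ^ n * ((n + 1) * u) ^ γ * I) := by gcongr
      _ = ((h ^ n)⁻¹ * u ^ n) * ((n + 1) ^ n * (n + 1) ^ γ * I * u ^ γ) := by
        rw [mul_pow, Real.mul_rpow (by positivity) hu0.le]; ring
      _ ≤ 3 ^ n * ((n + 1) ^ n * (n + 1) ^ γ * I * u ^ γ) := by gcongr
      _ = 3 ^ n * ((n + 1) ^ n * (n + 1) ^ γ * I) * u ^ γ := by ring
      _ ≤ _ := le_add_of_nonneg_left (by positivity)

theorem ae_prod_norm_rpow {N n : ℕ} (hn : 1 ≤ n) {p : ℝ} {pk : Fin N → ℝ}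
    (hpk : ∀ k, 0 < pk k) (e : Fin N → ℝ) :
    ∀ᵐ x : EuclideanSpace ℝ (Fin n),
      ∏ k, (‖x‖ ^ (e k * pk k)) ^ (p / pk k) = ‖x‖ ^ ((∑ k, e k) * p) := by
  have : Nonempty (Fin n) := ⟨⟨0, hn⟩⟩
  filter_upwards [compl_mem_ae_iff.2 (measure_singleton (0 : EuclideanSpace ℝ (Fin n)))] with x hx
  have hx0 : 0 < ‖x‖ := norm_pos_iff.2 hx
  rw [Finset.sum_mul, Real.rpow_sum_of_pos hx0]
  refine Finset.prod_congr rfl fun k _ => ?_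
  rw [← Real.rpow_mul hx0.le]
  congr 1
  have := (hpk k).ne'
  field_simp

/-- Power weights `w_k = ‖x‖ ^ (e_k p_k)` satisfy the multilinear condition as soon as the
functions occurring in it are locally integrable. -/
theorem isMultiApq_norm_rpow {N n : ℕ} (hn : 1 ≤ n) {p : ℝ} (hp : 0 < p) {pk qk : Fin N → ℝ}
    (hqk : ∀ k, 0 < qk k) (hpq : ∀ k, qk k < pk k) {e : Fin N → ℝ}
    (he : ∀ k, e k < n / qk k - n / pk k) (hsum : -(n / p) < ∑ k, e k) :
    IsMultiApq n N p pk qk (fun k x => ‖x‖ ^ (e k * pk k)) := by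
  have hpk : ∀ k, 0 < pk k := fun k => (hqk k).trans (hpq k)
  have hτ : ∀ k, 0 < 1 / qk k - 1 / pk k := fun k =>
    sub_pos.2 (one_div_lt_one_div_of_lt (hqk k) (hpq k))
  have h0 : -(n : ℝ) < (∑ k, e k) * p := by
    rw [neg_lt, ← neg_mul, ← lt_div_iff₀ hp]; linarith
  obtain ⟨K, hK, hKb⟩ := cube_average_norm_rpow_le hn h0
  have hγ : ∀ k, -(n : ℝ) < -e k / (1 / qk k - 1 / pk k) := fun k => by
    rw [lt_div_iff₀ (hτ k)]
    have := he k
    have : n / qk k - n / pk k = n * (1 / qk k - 1 / pk k) := by ring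
    linarith
  choose L hL hLb using fun k => cube_average_norm_rpow_le hn (hγ k)
  refine ⟨K ^ (1 / p) * ∏ k, L k ^ (1 / qk k - 1 / pk k), fun c h hh => ?_⟩
  have hu0 : 0 < ‖c‖ + h := by positivity
  have e1 : ∫ x in cube n c h, ∏ k, (‖x‖ ^ (e k * pk k)) ^ (p / pk k)
      = ∫ x in cube n c h, ‖x‖ ^ ((∑ k, e k) * p) :=
    integral_congr_ae (ae_restrict_of_ae (ae_prod_norm_rpow hn hpk e))
  have e2 : ∀ k, ∫ x in cube n c h,
      (‖x‖ ^ (e k * pk k)) ^ (1 - (pk k / qk k) / (pk k / qk k - 1))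
      = ∫ x in cube n c h, ‖x‖ ^ (-e k / (1 / qk k - 1 / pk k)) := fun k => by
    congr 1
    ext x
    rw [← Real.rpow_mul (norm_nonneg x)]
    congr 1
    have h1 := (hqk k).ne'
    have h2 := (hpk k).ne'
    have h3 : pk k - qk k ≠ 0 := (sub_pos.2 (hpq k)).ne'
    field_simp
    ring
  have hnn : ∀ γ : ℝ, 0 ≤ (h ^ n)⁻¹ * ∫ x in cube n c h, ‖x‖ ^ γ := fun γ =>
    mul_nonneg (by positivity) (integral_nonneg fun x => by positivity)
  simp only [e1, e2]
  calc _ ≤ (K * (‖c‖ + h) ^ ((∑ k, e k) * p)) ^ (1 / p) *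
        ∏ k, (L k * (‖c‖ + h) ^ (-e k / (1 / qk k - 1 / pk k))) ^ (1 / qk k - 1 / pk k) := by
        refine mul_le_mul (Real.rpow_le_rpow (hnn _) (hKb c h hh) (by positivity))
          (Finset.prod_le_prod (fun k _ => Real.rpow_nonneg (hnn _) _) fun k _ =>
            Real.rpow_le_rpow (hnn _) (hLb k c h hh) (hτ k).le)
          (Finset.prod_nonneg fun k _ => Real.rpow_nonneg (hnn _) _) (by positivity)
    _ = (K ^ (1 / p) * (‖c‖ + h) ^ (∑ k, e k)) *
        ∏ k, (L k ^ (1 / qk k - 1 / pk k) * (‖c‖ + h) ^ (-e k)) := by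
        rw [Real.mul_rpow hK (by positivity), ← Real.rpow_mul hu0.le, mul_assoc _ p,
          mul_one_div_cancel hp.ne', mul_one]
        congr 1
        refine Finset.prod_congr rfl fun k _ => ?_
        rw [Real.mul_rpow (hL k) (by positivity), ← Real.rpow_mul hu0.le,
          div_mul_cancel₀ _ (hτ k).ne']
    _ = K ^ (1 / p) * ∏ k, L k ^ (1 / qk k - 1 / pk k) := by
        rw [Finset.prod_mul_distrib, ← Real.rpow_sum_of_pos hu0, Finset.sum_neg_distrib,
          Real.rpow_neg hu0.le]
        field_simp
    _ ≤ _ := le_rfl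

theorem blk_apply {N n : ℕ} (ξ : EuclideanSpace ℝ (Fin N × Fin n)) (k : Fin N) (l : Fin n) :
    blk ξ k l = ξ (k, l) := rfl

theorem blk_add {N n : ℕ} (ξ η : EuclideanSpace ℝ (Fin N × Fin n)) (k : Fin N) :
    blk (ξ + η) k = blk ξ k + blk η k := rfl

theorem blk_smul {N n : ℕ} (r : ℝ) (ξ : EuclideanSpace ℝ (Fin N × Fin n)) (k : Fin N) :
    blk (r • ξ) k = r • blk ξ k := rfl

theorem continuous_blk {N n : ℕ} (k : Fin N) :
    Continuous fun ξ : EuclideanSpace ℝ (Fin N × Fin n) => blk ξ k := by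
  unfold blk
  refine (PiLp.continuous_toLp 2 (fun _ : Fin n => ℝ)).comp (continuous_pi fun i => ?_)
  fun_prop

theorem norm_blk_le {N n : ℕ} (ξ : EuclideanSpace ℝ (Fin N × Fin n)) (k : Fin N) :
    ‖blk ξ k‖ ≤ ‖ξ‖ := by
  rw [EuclideanSpace.norm_eq, EuclideanSpace.norm_eq]
  refine Real.sqrt_le_sqrt ?_
  rw [Fintype.sum_prod_type]
  exact Finset.single_le_sum (f := fun a => ∑ b, ‖ξ (a, b)‖ ^ 2)
    (fun _ _ => Finset.sum_nonneg fun _ _ => by positivity) (Finset.mem_univ k)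

/-- The vector of `ℝ^{Nn}` whose `i`-th block is `v` and whose other blocks vanish. -/
def singleBlk {N n : ℕ} (i : Fin N) (v : EuclideanSpace ℝ (Fin n)) :
    EuclideanSpace ℝ (Fin N × Fin n) :=
  WithLp.toLp 2 fun a => if a.1 = i then v a.2 else 0

theorem blk_singleBlk {N n : ℕ} (i k : Fin N) (v : EuclideanSpace ℝ (Fin n)) :
    blk (singleBlk i v) k = if k = i then v else 0 := by
  ext l
  by_cases h : k = i <;> simp [blk_apply, singleBlk, h]

theorem inner_singleBlk {N n : ℕ} (i : Fin N) (v : EuclideanSpace ℝ (Fin n))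
    (x : EuclideanSpace ℝ (Fin N × Fin n)) : ⟪x, singleBlk i v⟫ = ⟪v, blk x i⟫ := by
  simp only [PiLp.inner_apply, Fintype.sum_prod_type, singleBlk, blk_apply]
  rw [Finset.sum_eq_single i]
  · simp [mul_comm]
  · intro k _ hk
    simp [hk]
  · simp

section fint

variable {ι : Type*} [Fintype ι]

theorem fint_eq_fourier (f : EuclideanSpace ℝ ι → ℂ) (ξ : EuclideanSpace ℝ ι) :
    fint f ξ = FourierTransform.fourier f ((2 * π)⁻¹ • ξ) := by
  rw [Real.fourier_eq', fint]
  congr 1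
  ext x
  rw [smul_eq_mul, inner_smul_right]
  congr 2
  push_cast
  field_simp

/-- The transform `fint` of a Schwartz function is a Schwartz function. -/
theorem exists_schwartz_eq_fint (f : SchwartzMap (EuclideanSpace ℝ ι) ℂ) :
    ∃ g : SchwartzMap (EuclideanSpace ℝ ι) ℂ, ⇑g = fint f := by
  have h : ((2 * π)⁻¹ : ℝ) ≠ 0 := by positivity
  refine ⟨SchwartzMap.compCLMOfContinuousLinearEquiv ℂ
    (ContinuousLinearEquiv.smulLeft (Units.mk0 ((2 * π)⁻¹ : ℝ) h) :
      EuclideanSpace ℝ ι ≃L[ℝ] EuclideanSpace ℝ ι) (FourierTransform.fourier f), ?_⟩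
  ext ξ
  rw [fint_eq_fourier]
  rfl

theorem fint_comp_sub (f : EuclideanSpace ℝ ι → ℂ) (v ξ : EuclideanSpace ℝ ι) :
    fint (fun x => f (x - v)) ξ = Complex.exp (-(Complex.I * ((⟪v, ξ⟫ : ℝ) : ℂ))) * fint f ξ := by
  unfold fint
  rw [← integral_const_mul, ← integral_sub_right_eq_self (fun x => Complex.exp
    (-(Complex.I * ((⟪v, ξ⟫ : ℝ) : ℂ))) * (Complex.exp (-(Complex.I * ((⟪x, ξ⟫ : ℝ) : ℂ))) * f x)) v]
  congr 1
  ext x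
  rw [← mul_assoc, ← Complex.exp_add, inner_sub_left]
  congr 2
  push_cast
  ring

theorem fint_exp_mul (f : EuclideanSpace ℝ ι → ℂ) (v ξ : EuclideanSpace ℝ ι) :
    fint (fun x => Complex.exp (Complex.I * ((⟪x, v⟫ : ℝ) : ℂ)) * f x) ξ = fint f (ξ - v) := by
  unfold fint
  congr 1
  ext x
  rw [← mul_assoc, ← Complex.exp_add, inner_sub_right]
  congr 2
  push_cast
  ring

end fint

theorem sobolevProd_lt_top {N n : ℕ} {t : Fin N → ℝ} (ht : ∀ k, 0 ≤ t k)
    (F : SchwartzMap (EuclideanSpace ℝ (Fin N × Fin n)) ℂ) : sobolevProd t F < ⊤ := by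
  obtain ⟨H, hH⟩ := exists_schwartz_eq_fint F
  obtain ⟨M, hM⟩ := exists_nat_ge (∑ k, t k)
  set d := Module.finrank ℝ (EuclideanSpace ℝ (Fin N × Fin n)) + 1 with hd
  obtain ⟨C, hC⟩ : ∃ C : ℝ, ∀ ξ, (1 + ‖ξ‖) ^ (M + d) * ‖H ξ‖ ≤ C := by
    refine ⟨2 ^ (M + d) * (Finset.Iic (M + d, 0)).sup
      (fun m => SchwartzMap.seminorm ℝ m.1 m.2) H, fun ξ => ?_⟩
    simpa using SchwartzMap.one_add_le_sup_seminorm_apply (𝕜 := ℝ) (m := (M + d, 0))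
      le_rfl le_rfl H ξ
  unfold sobolevProd
  refine ENNReal.rpow_lt_top_of_nonneg (by norm_num) (ne_of_lt ?_)
  have hint : Integrable fun ξ : EuclideanSpace ℝ (Fin N × Fin n) =>
      C ^ 2 * (1 + ‖ξ‖) ^ (-(d : ℝ)) :=
    (integrable_one_add_norm (by rw [hd]; push_cast; linarith)).const_mul _
  refine lt_of_le_of_lt (lintegral_mono fun ξ => ENNReal.ofReal_le_ofReal ?_)
    hint.lintegral_lt_top
  have h1 : ∏ k, (1 + ‖blk ξ k‖ ^ 2) ^ t k ≤ (1 + ‖ξ‖) ^ (2 * M) := by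
    have hpos : (1 : ℝ) ≤ 1 + ‖ξ‖ ^ 2 := by nlinarith [sq_nonneg ‖ξ‖]
    calc ∏ k, (1 + ‖blk ξ k‖ ^ 2) ^ t k ≤ ∏ k, (1 + ‖ξ‖ ^ 2) ^ t k := by
          refine Finset.prod_le_prod (fun k _ => by positivity) fun k _ => ?_
          refine Real.rpow_le_rpow (by positivity) ?_ (ht k)
          have := norm_blk_le ξ k
          gcongr
      _ = (1 + ‖ξ‖ ^ 2) ^ (∑ k, t k) := (Real.rpow_sum_of_pos (by positivity) _ _).symm
      _ ≤ (1 + ‖ξ‖ ^ 2) ^ (M : ℝ) := Real.rpow_le_rpow_of_exponent_le hpos hM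
      _ = (1 + ‖ξ‖ ^ 2) ^ M := Real.rpow_natCast _ _
      _ ≤ ((1 + ‖ξ‖) ^ 2) ^ M := by
          gcongr
          nlinarith [norm_nonneg ξ]
      _ = _ := (pow_mul _ _ _).symm
  have hu : (1 : ℝ) ≤ 1 + ‖ξ‖ := by linarith [norm_nonneg ξ]
  have hu0 : (0 : ℝ) < 1 + ‖ξ‖ := by positivity
  rw [← hH]
  have h2 : (1 + ‖ξ‖) ^ (2 * M) * ‖H ξ‖ ^ 2 * (1 + ‖ξ‖) ^ (2 * d) ≤ C ^ 2 := by
    calc _ = ((1 + ‖ξ‖) ^ (M + d) * ‖H ξ‖) ^ 2 := by ring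
      _ ≤ C ^ 2 := by
        gcongr
        exact hC ξ
  rw [Real.rpow_neg hu0.le, Real.rpow_natCast, ← div_eq_mul_inv, le_div_iff₀ (by positivity)]
  calc _ ≤ (1 + ‖ξ‖) ^ (2 * M) * ‖H ξ‖ ^ 2 * (1 + ‖ξ‖) ^ (2 * d) := by
        gcongr
        omega
    _ ≤ C ^ 2 := h2

/-- Modulating the `i`-th variable by the frequency `v` costs a factor of the order of
`(1 + ‖v‖) ^ t_i`. -/
theorem sobolevProd_exp_mul_le {N n : ℕ} {t : Fin N → ℝ} (ht : ∀ k, 0 ≤ t k) (i : Fin N)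
    (v : EuclideanSpace ℝ (Fin n)) (F : EuclideanSpace ℝ (Fin N × Fin n) → ℂ) :
    sobolevProd t (fun η => Complex.exp (Complex.I * ((⟪v, blk η i⟫ : ℝ) : ℂ)) * F η) ≤
      ENNReal.ofReal ((2 * (1 + ‖v‖ ^ 2)) ^ (t i / 2)) * sobolevProd t F := by
  have hpt : ∀ ξ : EuclideanSpace ℝ (Fin N × Fin n),
      ∏ k, (1 + ‖blk (ξ + singleBlk i v) k‖ ^ 2) ^ t k ≤
        (2 * (1 + ‖v‖ ^ 2)) ^ t i * ∏ k, (1 + ‖blk ξ k‖ ^ 2) ^ t k := fun ξ => by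
    rw [← Finset.mul_prod_erase _ _ (Finset.mem_univ i),
      ← Finset.mul_prod_erase _ (fun k => (1 + ‖blk ξ k‖ ^ 2) ^ t k) (Finset.mem_univ i),
      ← mul_assoc, ← Real.mul_rpow (by positivity) (by positivity)]
    refine mul_le_mul (Real.rpow_le_rpow (by positivity) ?_ (ht i)) (le_of_eq ?_)
      (Finset.prod_nonneg fun k _ => by positivity) (by positivity)
    · rw [blk_add, blk_singleBlk, if_pos rfl]
      have h1 := norm_add_le (blk ξ i) v
      have h2 : ‖blk ξ i + v‖ ^ 2 ≤ (‖blk ξ i‖ + ‖v‖) ^ 2 := by gcongr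
      nlinarith [sq_nonneg (‖blk ξ i‖ - ‖v‖), mul_nonneg (sq_nonneg ‖blk ξ i‖) (sq_nonneg ‖v‖)]
    · refine Finset.prod_congr rfl fun k hk => ?_
      rw [blk_add, blk_singleBlk, if_neg (Finset.ne_of_mem_erase hk), add_zero]
  set c : ℝ := 2 * (1 + ‖v‖ ^ 2) with hc
  have hc0 : 0 < c := by positivity
  unfold sobolevProd
  simp only [← inner_singleBlk, fint_exp_mul]
  rw [← lintegral_sub_right_eq_self
    (fun ξ => ENNReal.ofReal ((∏ k, (1 + ‖blk ξ k‖ ^ 2) ^ t k) *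
      ‖fint F (ξ - singleBlk i v)‖ ^ 2)) (-singleBlk i v)]
  have hmul : ENNReal.ofReal (c ^ (t i / 2)) = ENNReal.ofReal (c ^ t i) ^ ((1 : ℝ) / 2) := by
    rw [ENNReal.ofReal_rpow_of_pos (by positivity), ← Real.rpow_mul hc0.le]
    congr 2
    ring
  rw [hmul, ← ENNReal.mul_rpow_of_nonneg _ _ (by norm_num), ← lintegral_const_mul' _ _ (by simp)]
  refine ENNReal.rpow_le_rpow (lintegral_mono fun ξ => ?_) (by norm_num)
  rw [← ENNReal.ofReal_mul (by positivity), sub_neg_eq_add, add_sub_cancel_right, ← mul_assoc]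
  refine ENNReal.ofReal_le_ofReal ?_
  gcongr
  exact hpt ξ

theorem sobolevProd_schwartz_mul_bound {N n : ℕ} {t : Fin N → ℝ} (ht : ∀ k, 0 ≤ t k) (i : Fin N)
    {ξ₀ : EuclideanSpace ℝ (Fin N × Fin n)} (θ : ContDiffBump ξ₀) (hθ : θ.rOut < ‖ξ₀‖)
    (Ψ : SchwartzMap (EuclideanSpace ℝ (Fin N × Fin n)) ℝ)
    (hΨ : tsupport ⇑Ψ ⊆ {ξ | 1 / 2 ≤ ‖ξ‖ ∧ ‖ξ‖ ≤ 2}) :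
    ∃ K : ℝ, 0 ≤ K ∧ ∀ v : EuclideanSpace ℝ (Fin n), 1 ≤ ‖v‖ → ∀ j : ℤ,
      sobolevProd t (fun η => Complex.exp (Complex.I * ((⟪v, blk ((2 : ℝ) ^ j • η) i⟫ : ℝ) : ℂ)) *
        (θ ((2 : ℝ) ^ j • η) : ℂ) * (Ψ η : ℂ)) ≤ ENNReal.ofReal (K * ‖v‖ ^ t i) := by
  set G : ℤ → EuclideanSpace ℝ (Fin N × Fin n) → ℂ :=
    fun j η => (θ ((2 : ℝ) ^ j • η) : ℂ) * (Ψ η : ℂ) with hG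
  have hΨc : HasCompactSupport ⇑Ψ := by
    refine HasCompactSupport.of_support_subset_isCompact
      (isCompact_closedBall (0 : EuclideanSpace ℝ (Fin N × Fin n)) 2) fun η hη => ?_
    rw [mem_closedBall_zero_iff]
    exact (hΨ (subset_tsupport _ hη)).2
  have hGc : ∀ j, HasCompactSupport (G j) := fun j =>
    (hΨc.comp_left (g := fun r : ℝ => (r : ℂ)) Complex.ofReal_zero).mul_left
  have hGs : ∀ j, ContDiff ℝ (↑(⊤ : ℕ∞)) (G j) := fun j => by
    refine ContDiff.mul ?_ ?_
    · exact Complex.ofRealCLM.contDiff.comp (θ.contDiff.comp (contDiff_const_smul _))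
    · exact Complex.ofRealCLM.contDiff.comp Ψ.smooth'
  have hfin : ∀ j, sobolevProd t (G j) < ⊤ := fun j =>
    sobolevProd_lt_top ht ((hGc j).toSchwartzMap (hGs j))
  obtain ⟨L, hL, -⟩ := exists_mem_Ico_zpow (x := (‖ξ₀‖ - θ.rOut) / 2) (by linarith)
    (one_lt_two : (1 : ℝ) < 2)
  obtain ⟨M, -, hM⟩ := exists_mem_Ico_zpow (x := 2 * (‖ξ₀‖ + θ.rOut))
    (by linarith [θ.rOut_pos, norm_nonneg ξ₀]) (one_lt_two : (1 : ℝ) < 2)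
  have hzero : ∀ j, j ∉ Finset.Icc L (M + 1) → sobolevProd t (G j) = 0 := fun j hj => by
    have : G j = fun _ => 0 := by
      ext η
      by_contra hne
      have h1 : θ ((2 : ℝ) ^ j • η) ≠ 0 := fun h => hne (by simp [hG, h])
      have h2 : Ψ η ≠ 0 := fun h => hne (by simp [hG, h])
      obtain ⟨h3, h4⟩ := hΨ (subset_tsupport _ h2)
      have h5 : (2 : ℝ) ^ j • η ∈ Metric.ball ξ₀ θ.rOut := by
        rw [← θ.support_eq]; exact h1
      rw [mem_ball_iff_norm] at h5
      have h6 : ‖(2 : ℝ) ^ j • η‖ = (2 : ℝ) ^ j * ‖η‖ := by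
        rw [norm_smul, Real.norm_of_nonneg (by positivity)]
      have h7 := abs_lt.1 ((abs_norm_sub_norm_le _ _).trans_lt h5)
      rw [h6] at h7
      have h8 : (0 : ℝ) < 2 ^ j := by positivity
      refine hj (Finset.mem_Icc.2 ⟨?_, ?_⟩)
      · by_contra! hlt
        have := zpow_lt_zpow_right₀ (one_lt_two : (1 : ℝ) < 2) hlt
        nlinarith
      · by_contra! hlt
        have := zpow_lt_zpow_right₀ (one_lt_two : (1 : ℝ) < 2) hlt
        nlinarith
    rw [this]
    simp [sobolevProd, fint]
  set κ : ℤ → ℝ := fun j =>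
    (2 * (1 + ((2 : ℝ) ^ j) ^ 2)) ^ (t i / 2) * (sobolevProd t (G j)).toReal with hκ
  have hκ0 : ∀ j, 0 ≤ κ j := fun j => by positivity
  refine ⟨∑ j ∈ Finset.Icc L (M + 1), κ j, Finset.sum_nonneg fun j _ => hκ0 j, fun v hv j => ?_⟩
  have hκle : κ j ≤ ∑ j ∈ Finset.Icc L (M + 1), κ j := by
    by_cases hj : j ∈ Finset.Icc L (M + 1)
    · exact Finset.single_le_sum (fun j _ => hκ0 j) hj
    · have : κ j = 0 := by simp [hκ, hzero j hj]
      rw [this]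
      exact Finset.sum_nonneg fun j _ => hκ0 j
  have hmod := sobolevProd_exp_mul_le ht i ((2 : ℝ) ^ j • v) (G j)
  simp only [blk_smul, inner_smul_right, mul_assoc]
  simp only [inner_smul_left, conj_trivial] at hmod
  refine hmod.trans ?_
  rw [← ENNReal.ofReal_toReal (hfin j).ne, ← ENNReal.ofReal_mul (by positivity)]
  refine ENNReal.ofReal_le_ofReal ?_
  have h1 : (2 * (1 + ‖(2 : ℝ) ^ j • v‖ ^ 2)) ^ (t i / 2) ≤
      (2 * (1 + ((2 : ℝ) ^ j) ^ 2)) ^ (t i / 2) * ‖v‖ ^ t i := by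
    have h2 : ‖v‖ ^ t i = (‖v‖ ^ 2) ^ (t i / 2) := by
      rw [← Real.rpow_natCast, ← Real.rpow_mul (norm_nonneg v)]
      congr 1
      push_cast
      ring
    rw [h2, ← Real.mul_rpow (by positivity) (by positivity)]
    refine Real.rpow_le_rpow (by positivity) ?_ (by linarith [ht i])
    rw [norm_smul, Real.norm_of_nonneg (by positivity : (0 : ℝ) ≤ 2 ^ j), mul_pow]
    nlinarith
  calc _ ≤ (2 * (1 + ((2 : ℝ) ^ j) ^ 2)) ^ (t i / 2) * ‖v‖ ^ t i *
        (sobolevProd t (G j)).toReal := by gcongr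
    _ = κ j * ‖v‖ ^ t i := by simp only [hκ]; ring
    _ ≤ _ := by gcongr

theorem continuous_fint_schwartz {ι : Type*} [Fintype ι]
    (f : SchwartzMap (EuclideanSpace ℝ ι) ℂ) : Continuous (fint f) := by
  obtain ⟨g, hg⟩ := exists_schwartz_eq_fint f
  exact hg ▸ g.continuous

theorem continuous_Tm {N n : ℕ} {m : EuclideanSpace ℝ (Fin N × Fin n) → ℂ} (hm : Continuous m)
    (hmc : HasCompactSupport m) (f : Fin N → SchwartzMap (EuclideanSpace ℝ (Fin n)) ℂ) :
    Continuous (Tm m fun k => ⇑(f k)) := by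
  have hH : Continuous fun ξ : EuclideanSpace ℝ (Fin N × Fin n) =>
      m ξ * ∏ k, fint (f k) (blk ξ k) :=
    hm.mul (continuous_finsetProd _ fun k _ =>
      (continuous_fint_schwartz (f k)).comp (continuous_blk k))
  have hint := hH.integrable_of_hasCompactSupport (μ := volume) hmc.mul_right
  unfold Tm
  refine continuous_const.mul ?_
  refine continuous_of_dominated (bound := fun ξ => ‖m ξ * ∏ k, fint (f k) (blk ξ k)‖)
    (fun x => ?_) (fun x => .of_forall fun ξ => ?_) hint.norm (.of_forall fun ξ => ?_)
  · simp only [mul_assoc]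
    refine (Continuous.mul ?_ hH).aestronglyMeasurable
    have : Continuous fun ξ : EuclideanSpace ℝ (Fin N × Fin n) => ∑ k, blk ξ k :=
      continuous_finsetSum _ fun k _ => continuous_blk k
    fun_prop
  · rw [mul_assoc, norm_mul, Complex.norm_exp_I_mul_ofReal, one_mul]
  · fun_prop

/-- Translating the `i`-th function and modulating the multiplier accordingly cancel out. -/
theorem Tm_exp_mul {N n : ℕ} (m : EuclideanSpace ℝ (Fin N × Fin n) → ℂ) (i : Fin N)
    (v : EuclideanSpace ℝ (Fin n)) (g : EuclideanSpace ℝ (Fin n) → ℂ) :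
    Tm (fun ξ => Complex.exp (Complex.I * ((⟪v, blk ξ i⟫ : ℝ) : ℂ)) * m ξ)
      (fun k => if k = i then fun x => g (x - v) else g) = Tm m fun _ => g := by
  ext x
  unfold Tm
  congr 2
  ext ξ
  have h : ∏ k, fint (if k = i then fun x => g (x - v) else g) (blk ξ k) =
      Complex.exp (-(Complex.I * ((⟪v, blk ξ i⟫ : ℝ) : ℂ))) * ∏ k, fint g (blk ξ k) := by
    rw [← Finset.mul_prod_erase _ _ (Finset.mem_univ i),
      ← Finset.mul_prod_erase _ (fun k => fint g (blk ξ k)) (Finset.mem_univ i), if_pos rfl,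
      fint_comp_sub, mul_assoc]
    congr 2
    refine Finset.prod_congr rfl fun k hk => ?_
    rw [if_neg (Finset.ne_of_mem_erase hk)]
  rw [h]
  have h2 : Complex.exp (Complex.I * ((⟪v, blk ξ i⟫ : ℝ) : ℂ)) *
      Complex.exp (-(Complex.I * ((⟪v, blk ξ i⟫ : ℝ) : ℂ))) = 1 := by
    rw [← Complex.exp_add, add_neg_cancel, Complex.exp_zero]
  linear_combination (Complex.exp (Complex.I * ((⟪x, ∑ k, blk ξ k⟫ : ℝ) : ℂ)) * m ξ *
    ∏ k, fint g (blk ξ k)) * h2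

theorem exists_bump_Tm_ne_zero {N n : ℕ} (hN : 0 < N) (hn : 0 < n)
    (g : SchwartzMap (EuclideanSpace ℝ (Fin n)) ℂ) {a : ℝ} (ha : 0 < a)
    (hg : ∫ x, g x = (a : ℂ)) :
    ∃ (ξ₀ : EuclideanSpace ℝ (Fin N × Fin n)) (θ : ContDiffBump ξ₀), θ.rOut < ‖ξ₀‖ ∧
      Tm (fun ξ => (θ ξ : ℂ)) (fun _ => ⇑g) 0 ≠ 0 := by
  have : Nonempty (Fin N × Fin n) := ⟨⟨⟨0, hN⟩, ⟨0, hn⟩⟩⟩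
  set H : EuclideanSpace ℝ (Fin N × Fin n) → ℂ := fun ξ => ∏ k, fint g (blk ξ k) with hHdef
  have hH : Continuous H := continuous_finsetProd _ fun k _ =>
    (continuous_fint_schwartz g).comp (continuous_blk k)
  have hH0 : 0 < (H 0).re := by
    have : H 0 = ((a ^ N : ℝ) : ℂ) := by
      have h0 : ∀ k, blk (0 : EuclideanSpace ℝ (Fin N × Fin n)) k = 0 := fun k => rfl
      simp [hHdef, h0, fint, hg]
    rw [this, Complex.ofReal_re]
    positivity
  obtain ⟨ρ, hρ, hρH⟩ := Metric.eventually_nhds_iff_ball.1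
    ((Complex.continuous_re.comp hH).continuousAt.eventually (lt_mem_nhds hH0))
  obtain ⟨ξ₀, hξ₀⟩ := exists_norm_eq (EuclideanSpace ℝ (Fin N × Fin n)) (half_pos hρ).le
  let θ : ContDiffBump ξ₀ := ⟨ρ / 8, ρ / 4, by positivity, by linarith⟩
  refine ⟨ξ₀, θ, by show ρ / 4 < _; linarith, ?_⟩
  have hθH : Continuous fun ξ => (θ ξ : ℂ) * H ξ :=
    (Complex.continuous_ofReal.comp θ.continuous).mul hH
  have hint : Integrable fun ξ => (θ ξ : ℂ) * H ξ :=
    hθH.integrable_of_hasCompactSupport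
      (θ.hasCompactSupport.comp_left (g := fun r : ℝ => (r : ℂ)) Complex.ofReal_zero).mul_right
  have hpos : 0 < ∫ ξ, θ ξ * (H ξ).re := by
    refine Continuous.integral_pos_of_hasCompactSupport_nonneg_nonzero (x := ξ₀)
      (θ.continuous.mul (Complex.continuous_re.comp hH)) θ.hasCompactSupport.mul_right
      (fun ξ => ?_) ?_
    · by_cases hξ : ξ ∈ Metric.ball ξ₀ θ.rOut
      · refine mul_nonneg θ.nonneg (hρH ξ ?_).le
        rw [mem_ball_iff_norm] at hξ
        rw [mem_ball_zero_iff]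
        have h1 : ‖ξ - ξ₀‖ < ρ / 4 := hξ
        have h2 := norm_le_norm_add_norm_sub' ξ ξ₀
        linarith
      · rw [← θ.support_eq, Function.notMem_support] at hξ
        simp [hξ]
    · refine mul_ne_zero ?_ (hρH ξ₀ ?_).ne'
      · rw [θ.one_of_mem_closedBall (Metric.mem_closedBall_self θ.rIn_pos.le)]
        exact one_ne_zero
      · rw [mem_ball_zero_iff]
        linarith
  have hne : ∫ ξ, (θ ξ : ℂ) * H ξ ≠ 0 := fun h0 => by
    have h1 := integral_re hint
    simp only [RCLike.re_to_complex, Complex.re_ofReal_mul] at h1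
    rw [h0] at h1
    simp at h1
    linarith
  unfold Tm
  refine mul_ne_zero (inv_ne_zero (Complex.ofReal_ne_zero.2 (by positivity))) ?_
  simpa using hne

theorem wLp_lt_top {n : ℕ} {q : ℝ} (hq : 0 < q) {b : ℝ} (hb : 0 ≤ b)
    {g : EuclideanSpace ℝ (Fin n) → ℂ} (hg : Continuous g) (hgc : HasCompactSupport g) :
    wLp q (fun x => ‖x‖ ^ b) g < ⊤ := by
  unfold wLp
  refine ENNReal.rpow_lt_top_of_nonneg (by positivity) (ne_of_lt ?_)
  have hcont : Continuous fun x => ‖g x‖ ^ q * ‖x‖ ^ b :=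
    (hg.norm.rpow_const fun _ => .inr hq.le).mul (continuous_norm.rpow_const fun _ => .inr hb)
  refine (hcont.integrable_of_hasCompactSupport (HasCompactSupport.mul_right
    (hgc.comp_left (g := fun z : ℂ => ‖z‖ ^ q) ?_))).lintegral_lt_top
  simp [hq.ne']

/-- Translates far away from the origin are small in the space weighted by a negative power. -/
theorem wLp_comp_sub_le {n : ℕ} {q : ℝ} (hq : 0 < q) {a : ℝ} (ha : a ≤ 0)
    {g : EuclideanSpace ℝ (Fin n) → ℂ} (hg : Function.support g ⊆ Metric.closedBall 0 1)
    {v : EuclideanSpace ℝ (Fin n)} (hv : 2 ≤ ‖v‖) :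
    wLp q (fun x => ‖x‖ ^ (a * q)) (fun x => g (x - v)) ≤
      ENNReal.ofReal ((‖v‖ / 2) ^ a) * wLp q (fun x => ‖x‖ ^ (0 : ℝ)) g := by
  have hv2 : 0 < ‖v‖ / 2 := by linarith
  have hmul : ENNReal.ofReal ((‖v‖ / 2) ^ a) =
      ENNReal.ofReal ((‖v‖ / 2) ^ (a * q)) ^ (1 / q) := by
    rw [ENNReal.ofReal_rpow_of_pos (by positivity), ← Real.rpow_mul hv2.le, mul_assoc,
      mul_one_div_cancel hq.ne', mul_one]
  unfold wLp
  rw [hmul, ← ENNReal.mul_rpow_of_nonneg _ _ (by positivity), ← lintegral_const_mul' _ _ (by simp)]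
  refine ENNReal.rpow_le_rpow ?_ (by positivity)
  rw [← lintegral_sub_right_eq_self (fun x => ENNReal.ofReal ((‖v‖ / 2) ^ (a * q)) *
    ENNReal.ofReal (‖g x‖ ^ q * ‖x‖ ^ (0 : ℝ))) v]
  refine lintegral_mono fun x => ?_
  simp only [Real.rpow_zero, mul_one]
  rw [← ENNReal.ofReal_mul (by positivity), mul_comm]
  refine ENNReal.ofReal_le_ofReal ?_
  by_cases hx : g (x - v) = 0
  · simp [hx, hq.ne']
  · refine mul_le_mul_of_nonneg_right (Real.rpow_le_rpow_of_nonpos hv2 ?_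
      (mul_nonpos_of_nonpos_of_nonneg ha hq.le)) (by positivity)
    have h1 := hg hx
    rw [mem_closedBall_zero_iff] at h1
    have h2 := norm_le_norm_add_norm_sub' v x
    rw [norm_sub_rev] at h2
    linarith

theorem wLp_ne_zero {n : ℕ} {q : ℝ} (hq : 0 < q) {w : EuclideanSpace ℝ (Fin n) → ℝ}
    (hwm : Measurable w) (hw : ∀ᵐ x, 0 < w x) {F : EuclideanSpace ℝ (Fin n) → ℂ}
    (hF : Continuous F) (hF0 : F 0 ≠ 0) : wLp q w F ≠ 0 := by
  intro h
  unfold wLp at h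
  have hq' : ¬ 1 / q < 0 := by
    have : 0 < 1 / q := by positivity
    linarith
  rw [ENNReal.rpow_eq_zero_iff] at h
  simp only [hq', and_false, or_false] at h
  rw [lintegral_eq_zero_iff' (by fun_prop)] at h
  have hae : F =ᵐ[volume] fun _ => 0 := by
    filter_upwards [h.1, hw] with x hx hwx
    by_contra hne
    have h1 : 0 < ‖F x‖ ^ q * w x := mul_pos (Real.rpow_pos_of_pos (norm_pos_iff.2 hne) q) hwx
    exact (ENNReal.ofReal_pos.2 h1).ne' hx
  exact hF0 (congrFun ((hF.ae_eq_iff_eq volume continuous_const).1 hae) 0)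

theorem exists_exponents {N n : ℕ} (hN : 2 ≤ N) {p : ℝ} {sk pk : Fin N → ℝ}
    (hpk : ∀ k, 0 < pk k) (hn : 0 < n) (hs : ∀ k, 0 < sk k) (hδ : ∀ k, 0 < sk k - n / pk k)
    (hp : 1 / p = ∑ k, 1 / pk k) :
    ∃ (e : Fin N → ℝ) (i : Fin N), e i < -sk i ∧ (∀ k, k ≠ i → 0 ≤ e k) ∧
      (∀ k, e k < sk k - n / pk k) ∧ -(n / p) < ∑ k, e k := by
  have : Nonempty (Fin N) := ⟨⟨0, by omega⟩⟩
  have : Nontrivial (Fin N) := Fin.nontrivial_iff_two_le.2 hN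
  obtain ⟨i, hi⟩ := Finite.exists_min sk
  obtain ⟨j, hj⟩ := exists_ne i
  have hn' : (0 : ℝ) < n := by exact_mod_cast hn
  set δ := sk j - n / pk j with hδdef
  set τ := n / pk i with hτ
  have hδ0 : 0 < δ := hδ j
  have hτ0 : 0 < τ := div_pos hn' (hpk i)
  obtain ⟨ε, hε0, hεδ, hετ⟩ : ∃ ε : ℝ, 0 < ε ∧ ε < δ ∧ 2 * ε < τ :=
    ⟨min δ τ / 4, by positivity, by linarith [min_le_left δ τ], by linarith [min_le_right δ τ]⟩
  refine ⟨fun k => (if k = i then -(sk i + ε) else 0) + (if k = j then δ - ε else 0), i,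
    ?_, fun k hk => ?_, fun k => ?_, ?_⟩
  · simp [hj.symm, hε0]
  · simp only [hk, if_false, zero_add]
    split_ifs <;> linarith
  · have h1 := hδ k
    have h2 := hs i
    by_cases hki : k = i
    · subst hki
      simp only [if_true, hj.symm, if_false]
      linarith
    · by_cases hkj : k = j
      · subst hkj
        simp only [hki, if_true, if_false]
        linarith
      · simp only [hki, hkj, if_false]
        linarith
  · have h1 : n / p = ∑ k, n / pk k := by
      rw [div_eq_mul_one_div, hp, Finset.mul_sum]
      exact Finset.sum_congr rfl fun k _ => (div_eq_mul_one_div _ _).symm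
    have h2 : τ + n / pk j ≤ ∑ k, n / pk k := by
      rw [hτ, ← Finset.sum_pair (f := fun k => n / pk k) hj.symm]
      exact Finset.sum_le_univ_sum_of_nonneg fun k => (div_pos hn' (hpk k)).le
    rw [Finset.sum_add_distrib]
    simp only [Finset.sum_ite_eq', Finset.mem_univ, if_true]
    have := hi j
    linarith

theorem exists_nonneg_bump (n : ℕ) :
    ∃ g : SchwartzMap (EuclideanSpace ℝ (Fin n)) ℂ, HasCompactSupport ⇑g ∧
      Function.support ⇑g ⊆ Metric.closedBall 0 1 ∧ ∃ a : ℝ, 0 < a ∧ ∫ x, g x = (a : ℂ) := by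
  let φ : ContDiffBump (0 : EuclideanSpace ℝ (Fin n)) := ⟨1 / 2, 1, by norm_num, by norm_num⟩
  have hc : HasCompactSupport fun x => (φ x : ℂ) :=
    φ.hasCompactSupport.comp_left (g := fun r : ℝ => (r : ℂ)) Complex.ofReal_zero
  refine ⟨hc.toSchwartzMap (Complex.ofRealCLM.contDiff.comp φ.contDiff), hc, fun x hx => ?_,
    ∫ x, φ x, φ.integral_pos, integral_ofReal⟩
  have h1 : φ x ≠ 0 := fun h => hx (by show (φ x : ℂ) = 0; simp [h])
  exact Metric.ball_subset_closedBall (φ.support_eq ▸ h1 : x ∈ Metric.ball 0 φ.rOut)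

/-- Translates of a Schwartz function are Schwartz functions. -/
theorem exists_schwartz_comp_sub {n : ℕ} {g : SchwartzMap (EuclideanSpace ℝ (Fin n)) ℂ}
    (hg : HasCompactSupport ⇑g) (v : EuclideanSpace ℝ (Fin n)) :
    ∃ h : SchwartzMap (EuclideanSpace ℝ (Fin n)) ℂ, ⇑h = fun x => g (x - v) := by
  have hc : HasCompactSupport fun x => g (x - v) :=
    hg.comp_homeomorph (Homeomorph.subRight v)
  exact ⟨hc.toSchwartzMap (g.smooth'.comp (contDiff_id.sub contDiff_const)), rfl⟩

/-- Let `N ≥ 2`, `n ≥ 1`, and for each `k` let `n/2 < s_k ≤ n`,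
`n/s_k < p_k < ∞`, `q_k = n/s_k`, with `1/p = 1/p₁ + ⋯ + 1/p_N`.  Then there exist
nonnegative weights `w₁,…,w_N` with `(w₁,…,w_N) ∈ A_{P⃗/Q⃗}` such that for every
`Ψ ∈ 𝒮(ℝ^{Nn})` supported in `{1/2 ≤ |ξ| ≤ 2}` with `Σ_{k∈ℤ} Ψ(ξ/2^k) = 1` for `ξ ≠ 0`,
there is no constant `C > 0` such that for all bounded measurable `m` and all Schwartz
`f₁,…,f_N`,
`‖T_m(f⃗)‖_{L^p(ν_w)} ≤ C · (sup_{j∈ℤ} ‖m(2^j·)Ψ‖_{W^{(s₁,…,s_N)}}) · Π_k ‖f_k‖_{L^{p_k}(w_k)}`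
(the supremum over `j` is encoded through an arbitrary upper bound `A` of all the
product-type Sobolev norms of the pieces `m_j`). -/
theorem stmt_2 (N n : ℕ) (hN : 2 ≤ N) (hn : 1 ≤ n) (p : ℝ) (sk pk : Fin N → ℝ)
    (hsk1 : ∀ k, (n : ℝ) / 2 < sk k) (hsk2 : ∀ k, sk k ≤ (n : ℝ))
    (hpk : ∀ k, (n : ℝ) / sk k < pk k)
    (hp : 1 / p = ∑ k, 1 / pk k) :
    ∃ w : Fin N → EuclideanSpace ℝ (Fin n) → ℝ,
      (∀ k x, 0 ≤ w k x) ∧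
      IsMultiApq n N p pk (fun k => (n : ℝ) / sk k) w ∧
      ∀ Ψ : SchwartzMap (EuclideanSpace ℝ (Fin N × Fin n)) ℝ,
        tsupport ⇑Ψ ⊆ {ξ | 1 / 2 ≤ ‖ξ‖ ∧ ‖ξ‖ ≤ 2} →
        (∀ ξ : EuclideanSpace ℝ (Fin N × Fin n), ξ ≠ 0 →
          ∑' j : ℤ, Ψ (((2 : ℝ) ^ j)⁻¹ • ξ) = 1) →
        ¬ ∃ C : ℝ, 0 < C ∧
          ∀ m : EuclideanSpace ℝ (Fin N × Fin n) → ℂ,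
            Measurable m → (∃ B : ℝ, ∀ ξ, ‖m ξ‖ ≤ B) →
          ∀ A : ℝ,
            (∀ j : ℤ, sobolevProd sk
                (fun η => m ((2 : ℝ) ^ j • η) * (Ψ η : ℂ)) ≤ ENNReal.ofReal A) →
          ∀ f : Fin N → SchwartzMap (EuclideanSpace ℝ (Fin n)) ℂ,
            wLp p (fun x => ∏ k, w k x ^ (p / pk k)) (Tm m (fun k => ⇑(f k)))
              ≤ ENNReal.ofReal C * ENNReal.ofReal A * ∏ k, wLp (pk k) (w k) ⇑(f k) := by
  have hn0 : (0 : ℝ) < n := by exact_mod_cast hn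
  have hs0 : ∀ k, 0 < sk k := fun k => lt_trans (by positivity) (hsk1 k)
  have hqk : ∀ k, 0 < n / sk k := fun k => div_pos hn0 (hs0 k)
  have hpk0 : ∀ k, 0 < pk k := fun k => (hqk k).trans (hpk k)
  have hN0 : 0 < N := by omega
  have : Nonempty (Fin N) := ⟨⟨0, hN0⟩⟩
  have : Nonempty (Fin n) := ⟨⟨0, hn⟩⟩
  have hp0 : 0 < p := by
    rw [← one_div_pos, hp]
    exact Finset.sum_pos (fun k _ => one_div_pos.2 (hpk0 k)) Finset.univ_nonempty
  have hδ : ∀ k, 0 < sk k - n / pk k := fun k => by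
    rw [sub_pos, div_lt_iff₀ (hpk0 k), mul_comm, ← div_lt_iff₀ (hs0 k)]
    exact hpk k
  obtain ⟨e, i, hei, henn, heδ, hesum⟩ := exists_exponents hN hpk0 hn hs0 hδ hp
  refine ⟨fun k x => ‖x‖ ^ (e k * pk k), fun k x => by positivity,
    isMultiApq_norm_rpow hn hp0 hqk hpk (fun k => ?_) hesum, fun Ψ hΨ _ => ?_⟩
  · rw [div_div_cancel₀ hn0.ne']
    exact heδ k
  rintro ⟨C, hC, hbound⟩
  obtain ⟨g, hgc, hgs, a, ha, hga⟩ := exists_nonneg_bump n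
  obtain ⟨ξ₀, θ, hθ, hT0⟩ := exists_bump_Tm_ne_zero hN0 hn g ha hga
  obtain ⟨K, hK, hKb⟩ := sobolevProd_schwartz_mul_bound (fun k => (hs0 k).le) i θ hθ Ψ hΨ
  have hei0 : e i ≤ 0 := by linarith [hs0 i]
  set ν : EuclideanSpace ℝ (Fin n) → ℝ := fun x => ∏ k, (‖x‖ ^ (e k * pk k)) ^ (p / pk k) with hν
  have hνm : Measurable ν := Finset.measurable_prod _ fun k _ =>
    (measurable_norm.pow_const _).pow_const _
  have hν0 : ∀ᵐ x, 0 < ν x := by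
    filter_upwards [compl_mem_ae_iff.2 (measure_singleton (0 : EuclideanSpace ℝ (Fin n)))]
      with x hx
    have : 0 < ‖x‖ := norm_pos_iff.2 hx
    exact Finset.prod_pos fun k _ => by positivity
  set c₀ := wLp p ν (Tm (fun ξ => (θ ξ : ℂ)) fun _ : Fin N => ⇑g) with hc₀
  have hθc : Continuous fun ξ => (θ ξ : ℂ) := Complex.continuous_ofReal.comp θ.continuous
  have hc₀ne : c₀ ≠ 0 := wLp_ne_zero hp0 hνm hν0
    (continuous_Tm hθc (θ.hasCompactSupport.comp_left (g := fun r : ℝ => (r : ℂ))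
      Complex.ofReal_zero) fun _ => g) hT0
  set D := wLp (pk i) (fun x => ‖x‖ ^ (0 : ℝ)) g *
    ∏ k ∈ Finset.univ.erase i, wLp (pk k) (fun x => ‖x‖ ^ (e k * pk k)) g with hD
  have hDtop : D < ⊤ := by
    refine ENNReal.mul_lt_top (wLp_lt_top (hpk0 i) le_rfl g.continuous hgc)
      (ENNReal.prod_lt_top fun k hk => wLp_lt_top (hpk0 k)
        (mul_nonneg (henn k (Finset.ne_of_mem_erase hk)) (hpk0 k).le) g.continuous hgc)
  have main : ∀ R : ℝ, 2 ≤ R →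
      c₀ ≤ ENNReal.ofReal (C * K * (1 / 2) ^ e i * D.toReal * R ^ (sk i + e i)) := fun R hR => by
    have hR0 : 0 < R := by linarith
    obtain ⟨v, hv⟩ := exists_norm_eq (EuclideanSpace ℝ (Fin n)) hR0.le
    obtain ⟨h, hh⟩ := exists_schwartz_comp_sub hgc v
    have hmc : Continuous fun ξ : EuclideanSpace ℝ (Fin N × Fin n) =>
        Complex.exp (Complex.I * ((⟪v, blk ξ i⟫ : ℝ) : ℂ)) * (θ ξ : ℂ) := by
      have := continuous_blk (N := N) (n := n) i
      exact Continuous.mul (by fun_prop) hθc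
    have hB := hbound _ hmc.measurable ⟨1, fun ξ => by
      rw [norm_mul, Complex.norm_exp_I_mul_ofReal, one_mul, Complex.norm_real,
        Real.norm_of_nonneg θ.nonneg]
      exact θ.le_one⟩ (K * ‖v‖ ^ sk i) (hKb v (by linarith)) (fun k => if k = i then h else g)
    have hf : (fun k => ⇑(if k = i then h else g)) =
        fun k => if k = i then fun x => g (x - v) else ⇑g := by
      ext1 k
      split_ifs
      · exact hh
      · rfl
    rw [hf, Tm_exp_mul] at hB
    refine hB.trans ?_
    have hprod : ∏ k, wLp (pk k) (fun x => ‖x‖ ^ (e k * pk k)) ⇑(if k = i then h else g) ≤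
        ENNReal.ofReal ((R / 2) ^ e i) * D := by
      rw [← Finset.mul_prod_erase _ _ (Finset.mem_univ i), if_pos rfl, hh, hD, ← mul_assoc]
      refine mul_le_mul' ?_ (le_of_eq (Finset.prod_congr rfl fun k hk => ?_))
      · rw [← hv]
        exact wLp_comp_sub_le (hpk0 i) hei0 hgs (by linarith)
      · rw [if_neg (Finset.ne_of_mem_erase hk)]
    refine (mul_le_mul_right hprod _).trans (le_of_eq ?_)
    rw [← ENNReal.ofReal_toReal hDtop.ne, ← ENNReal.ofReal_mul (by positivity),
      ← ENNReal.ofReal_mul (by positivity), ← ENNReal.ofReal_mul (by positivity),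
      ENNReal.toReal_ofReal ENNReal.toReal_nonneg, hv, Real.rpow_add hR0,
      div_eq_mul_one_div R 2, Real.mul_rpow hR0.le (by norm_num)]
    congr 1
    ring
  have hlim : Filter.Tendsto (fun R : ℝ => ENNReal.ofReal
      (C * K * (1 / 2) ^ e i * D.toReal * R ^ (sk i + e i))) Filter.atTop (nhds 0) := by
    have h1 := tendsto_rpow_neg_atTop (y := -(sk i + e i)) (by linarith)
    rw [neg_neg] at h1
    have h2 := ENNReal.tendsto_ofReal (h1.const_mul (C * K * (1 / 2) ^ e i * D.toReal))
    simpa using h2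
  refine hc₀ne (le_antisymm (ge_of_tendsto hlim ?_) zero_le)
  filter_upwards [Filter.eventually_ge_atTop 2] with R hR using main R hR

end
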